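/- Hölder estimate for discrete elliptic difference equations, uniform in the mesh size. Fix constants 0 < λ_min ≤ λ_max. There exist constants C > 0 and γ ∈ (0,1) depending only on n, λ_min and λ_max (and independent of ε) such that the following holds for every ε > 0. Let λ_i : εℤⁿ → ℝ satisfy λ_min ≤ λ_i(x) ≤ λ_max for i = 1,…,n, and let u : B₁ ∩ εℤⁿ → ℝ satisfy |u| ≤ 1 on B₁ ∩ εℤⁿ and Lu(x) = 0 at every lattice point x ∈ B₁ ∩ εℤⁿ with x ± εe_i ∈ B₁ for all i. Then |u(x) − u(y)| ≤ C|x−y|^γ for all x, y ∈ B_{1/2} ∩ εℤⁿ. -/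

import Mathlib

open Metric

noncomputable section

abbrev En (n : ℕ) := EuclideanSpace ℝ (Fin n)

/-- `x` belongs to the lattice `εℤⁿ`. -/
def IsLatticePoint {n : ℕ} (ε : ℝ) (x : En n) : Prop := ∀ i, ∃ m : ℤ, x i = ε * m

/-- The discrete elliptic operator
`Lu(x) = Σᵢ λᵢ(x)[u(x+εeᵢ)+u(x−εeᵢ)−2u(x)]/ε²`. -/
def discreteL {n : ℕ} (ε : ℝ) (lam : Fin n → En n → ℝ) (u : En n → ℝ) (x : En n) : ℝ :=
  ∑ i, lam i x *
    (u (x + EuclideanSpace.single i ε) + u (x - EuclideanSpace.single i ε) - 2 * u x) / ε ^ 2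

set_option linter.unusedVariables false

namespace DH

abbrev Zn (n : ℕ) := Fin n → ℤ

variable {n : ℕ}

/-- lattice cube of sup-radius `R`. -/
def D (c : Zn n) (R : ℤ) : Finset (Zn n) := Finset.Icc (fun i => c i - R) (fun i => c i + R)

lemma mem_D {c : Zn n} {R : ℤ} {x : Zn n} : x ∈ D c R ↔ ∀ i, c i - R ≤ x i ∧ x i ≤ c i + R := by
  simp only [D, Finset.mem_Icc, Pi.le_def]
  exact ⟨fun h i => ⟨h.1 i, h.2 i⟩, fun h => ⟨fun i => (h i).1, fun i => (h i).2⟩⟩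

lemma card_D (c : Zn n) (r : ℕ) : (D c (r : ℤ)).card = (2 * r + 1) ^ n := by
  simp only [D, Pi.card_Icc, Int.card_Icc]
  have : ∀ i : Fin n, (c i + (r : ℤ) + 1 - (c i - r)).toNat = 2 * r + 1 := fun i => by omega
  simp [this]

def ee (i : Fin n) : Zn n := Pi.single i 1

lemma ee_same (i : Fin n) : ee i i = 1 := by simp [ee]
lemma ee_ne {i j : Fin n} (h : j ≠ i) : ee i j = 0 := by simp [ee, h]
lemma ee_bd (i j : Fin n) : 0 ≤ ee i j ∧ ee i j ≤ 1 := by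
  by_cases h : j = i
  · subst h; simp [ee_same]
  · simp [ee_ne h]

lemma add_mem_D {c x : Zn n} {R R' : ℤ} (h : x ∈ D c R) (hR : R + 1 ≤ R') (i : Fin n) :
    x + ee i ∈ D c R' := by
  rw [mem_D] at *
  intro j
  have := h j
  have := ee_bd i j
  simp only [Pi.add_apply]
  omega

lemma sub_mem_D {c x : Zn n} {R R' : ℤ} (h : x ∈ D c R) (hR : R + 1 ≤ R') (i : Fin n) :
    x - ee i ∈ D c R' := by
  rw [mem_D] at *
  intro j
  have := h j
  have := ee_bd i j
  simp only [Pi.sub_apply]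
  omega

/-- pure second difference -/
def dd (u : Zn n → ℝ) (x : Zn n) (i : Fin n) : ℝ := u (x + ee i) + u (x - ee i) - 2 * u x

/-- supersolution at `x` -/
def S (l L : ℝ) (u : Zn n → ℝ) (x : Zn n) : Prop :=
  ∃ a : Fin n → ℝ, (∀ i, l ≤ a i ∧ a i ≤ L) ∧ ∑ i, a i * dd u x i ≤ 0

lemma S_smul {l L : ℝ} {u : Zn n → ℝ} {x : Zn n} (h : S l L u x) {t : ℝ} (ht : 0 ≤ t) :
    S l L (fun y => t * u y) x := by
  obtain ⟨a, ha, hs⟩ := h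
  refine ⟨a, ha, ?_⟩
  have : ∑ i, a i * dd (fun y => t * u y) x i = t * ∑ i, a i * dd u x i := by
    rw [Finset.mul_sum]
    refine Finset.sum_congr rfl fun i _ => ?_
    simp only [dd]; ring
  rw [this]
  exact mul_nonpos_of_nonneg_of_nonpos ht hs

def sq (x : Zn n) : ℝ := ∑ i, (x i : ℝ) ^ 2

lemma sq_nonneg' (x : Zn n) : 0 ≤ sq x := Finset.sum_nonneg fun _ _ => sq_nonneg _

lemma sq_add (x : Zn n) (i : Fin n) : sq (x + ee i) = sq x + 2 * x i + 1 := by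
  have : sq (x + ee i) - sq x = ∑ j, if j = i then (2 * (x j : ℝ) + 1) else 0 := by
    simp only [sq]
    rw [← Finset.sum_sub_distrib]
    refine Finset.sum_congr rfl fun j _ => ?_
    by_cases h : j = i
    · subst h; simp [ee_same]; ring
    · simp [ee_ne h, h]
  simp at this
  linarith

lemma sq_sub (x : Zn n) (i : Fin n) : sq (x - ee i) = sq x - 2 * x i + 1 := by
  have h := sq_add (x - ee i) i
  simp [ee_same] at h
  linarith

lemma le_sq (x : Zn n) (i : Fin n) : (x i : ℝ) ^ 2 ≤ sq x :=
  Finset.single_le_sum (f := fun i => (x i : ℝ) ^ 2) (fun _ _ => sq_nonneg _) (Finset.mem_univ i)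

lemma sq_le {x : Zn n} {T : ℝ} (h : ∀ i, |(x i : ℝ)| ≤ T) : sq x ≤ n * T ^ 2 := by
  have : sq x ≤ ∑ i : Fin n, T ^ 2 := Finset.sum_le_sum fun i _ => by
    rw [← sq_abs]
    have := abs_nonneg (x i : ℝ)
    have := h i
    gcongr
  simpa using this

/-- Sliding paraboloids. -/
lemma slide {l L : ℝ} (hl : 0 < l) (hlL : l ≤ L) (K : ℕ) (hK : n * L / l + 1 ≤ K)
    (u : Zn n → ℝ) (x1 : Zn n) (r : ℕ) (hr : 1 ≤ r)
    (hu : ∀ x ∈ D x1 (((n + 2) * r + 1 : ℕ) : ℤ), 0 ≤ u x ∧ S l L u x) (h1 : u x1 ≤ 1) :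
    (2 * r + 1) ^ n ≤ (2 * K + 1) ^ n *
      ((D x1 (((n + 2) * r : ℕ) : ℤ)).filter (fun x => u x ≤ n + 1)).card := by
  classical
  have hr0 : (0 : ℝ) < r := by exact_mod_cast hr
  set b : ℝ := 1 / (r : ℝ) ^ 2 with hb
  have hb0 : 0 < b := by positivity
  have hbr : b * (r : ℝ) ^ 2 = 1 := by rw [hb]; field_simp
  have hne : (D x1 (((n + 2) * r + 1 : ℕ) : ℤ)).Nonempty := ⟨x1, by
    rw [mem_D]; intro i; constructor <;> omega⟩
  have hex : ∀ y : Zn n, ∃ x ∈ D x1 (((n + 2) * r + 1 : ℕ) : ℤ),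
      ∀ z ∈ D x1 (((n + 2) * r + 1 : ℕ) : ℤ), u x + b * sq (x - y) ≤ u z + b * sq (z - y) :=
    fun y => Finset.exists_min_image _ (fun x => u x + b * sq (x - y)) hne
  choose f hf hmin using hex
  have key : ∀ y ∈ D x1 (r : ℤ), f y ∈ (D x1 (((n + 2) * r : ℕ) : ℤ)).filter (fun x => u x ≤ n + 1) := by
    intro y hy
    have hy' := mem_D.1 hy
    have h2 := hmin y x1 (by rw [mem_D]; intro i; constructor <;> omega)
    have h3 : sq (x1 - y) ≤ n * (r : ℝ) ^ 2 := by
      apply sq_le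
      intro i
      have := hy' i
      have h4 : |(x1 - y) i| ≤ (r : ℤ) := by
        rw [abs_le]; simp only [Pi.sub_apply]; constructor <;> omega
      exact_mod_cast h4
    have h4 : b * sq (x1 - y) ≤ n := by
      calc b * sq (x1 - y) ≤ b * (n * (r : ℝ) ^ 2) := by gcongr
        _ = n * (b * (r : ℝ) ^ 2) := by ring
        _ = n := by rw [hbr, mul_one]
    have h5 : 0 ≤ u (f y) := (hu _ (hf y)).1
    have h6 : 0 ≤ b * sq (f y - y) := mul_nonneg hb0.le (sq_nonneg' _)
    rw [Finset.mem_filter]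
    refine ⟨?_, by linarith⟩
    rw [mem_D]
    intro i
    have h7 : b * ((f y - y) i : ℝ) ^ 2 ≤ n + 1 := by
      have := mul_le_mul_of_nonneg_left (le_sq (f y - y) i) hb0.le
      linarith
    have h8 : ((f y - y) i : ℝ) ^ 2 ≤ ((n + 1 : ℝ) * r) ^ 2 := by
      have e : ((f y - y) i : ℝ) ^ 2 = (b * ((f y - y) i : ℝ) ^ 2) * (r : ℝ) ^ 2 := by
        rw [mul_comm b, mul_assoc, hbr, mul_one]
      rw [e, mul_pow]
      have : (b * ((f y - y) i : ℝ) ^ 2) ≤ (n + 1 : ℝ) ^ 2 := by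
        have : (0 : ℝ) ≤ n := by positivity
        nlinarith
      gcongr
    have h9 := abs_le_of_sq_le_sq h8 (by positivity)
    have h10 : |(f y - y) i| ≤ ((n + 1) * r : ℤ) := by
      exact_mod_cast h9
    rw [abs_le] at h10
    simp only [Pi.sub_apply] at h10
    have := hy' i
    push_cast
    constructor <;> linarith
  have hcard := Finset.card_le_mul_card_image_of_maps_to (s := D x1 (r : ℤ)) key ((2 * K + 1) ^ n) ?_
  · rw [card_D] at hcard; exact hcard
  intro x hx
  rw [Finset.mem_filter] at hx
  rcases Finset.eq_empty_or_nonempty ((D x1 (r : ℤ)).filter (fun y => f y = x)) with he | ⟨y0, hy0⟩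
  · rw [he]; simp
  rw [← card_D y0 K]
  apply Finset.card_le_card
  intro y hy
  rw [Finset.mem_filter] at hy hy0
  have hxD : x ∈ D x1 (((n + 2) * r + 1 : ℕ) : ℤ) := by rw [← hy.2]; exact hf y
  have up : ∀ z : Zn n, f z = x → ∀ i, 0 ≤ u (x + ee i) - u x + b * (2 * ((x i : ℝ) - z i) + 1) := by
    intro z hz i
    have := hmin z (x + ee i) (add_mem_D hx.1 (by push_cast; omega) i)
    rw [hz, show x + ee i - z = (x - z) + ee i by abel, sq_add] at this
    simp at this
    linarith
  have dn : ∀ z : Zn n, f z = x → ∀ i, 0 ≤ u (x - ee i) - u x + b * (-2 * ((x i : ℝ) - z i) + 1) := by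
    intro z hz i
    have := hmin z (x - ee i) (sub_mem_D hx.1 (by push_cast; omega) i)
    rw [hz, show x - ee i - z = (x - z) - ee i by abel, sq_sub] at this
    simp at this
    linarith
  have dlow : ∀ i, -(2 * b) ≤ dd u x i := by
    intro i
    have h1 := up y hy.2 i
    have h2 := dn y hy.2 i
    simp only [dd]; linarith
  have dup : ∀ i, dd u x i ≤ 2 * b * (n * L / l) := by
    intro i
    obtain ⟨a, ha, hs⟩ := (hu x hxD).2
    have h1 : ∑ j, a j * (dd u x j + 2 * b) ≤ 2 * b * (n * L) := by
      have e : ∑ j, a j * (dd u x j + 2 * b) = ∑ j, a j * dd u x j + 2 * b * ∑ j, a j := by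
        rw [Finset.mul_sum, ← Finset.sum_add_distrib]
        exact Finset.sum_congr rfl fun j _ => by ring
      have : ∑ j, a j ≤ n * L := by
        have : ∑ j, a j ≤ ∑ j : Fin n, L := Finset.sum_le_sum fun j _ => (ha j).2
        simpa using this
      have := mul_le_mul_of_nonneg_left this (show 0 ≤ 2 * b by positivity)
      linarith
    have h2 : a i * (dd u x i + 2 * b) ≤ ∑ j, a j * (dd u x j + 2 * b) :=
      Finset.single_le_sum (f := fun j => a j * (dd u x j + 2 * b))
        (fun j _ => mul_nonneg (hl.le.trans (ha j).1) (by linarith [dlow j])) (Finset.mem_univ i)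
    have h3 : l * (dd u x i + 2 * b) ≤ a i * (dd u x i + 2 * b) :=
      mul_le_mul_of_nonneg_right (ha i).1 (by linarith [dlow i])
    have h4 : dd u x i + 2 * b ≤ 2 * b * (n * L) / l := by
      rw [le_div_iff₀ hl]; linarith
    have : 2 * b * (n * L) / l = 2 * b * (n * L / l) := by ring
    linarith
  have dist : ∀ z z' : Zn n, f z = x → f z' = x → ∀ i, z i - z' i ≤ (K : ℤ) := by
    intro z z' hz hz' i
    have h1 := up z hz i
    have h2 := dn z' hz' i
    have h3 := dup i
    simp only [dd] at h3
    have h4 : 2 * b * ((z i : ℝ) - z' i) ≤ 2 * b * (n * L / l + 1) := by linarith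
    have h5 : ((z i : ℝ) - z' i) ≤ n * L / l + 1 := le_of_mul_le_mul_left h4 (by positivity)
    have : ((z i : ℝ) - z' i) ≤ K := h5.trans hK
    exact_mod_cast this
  rw [mem_D]
  intro i
  have h1 := dist y y0 hy.2 hy0.2 i
  have h2 := dist y0 y hy0.2 hy.2 i
  constructor <;> omega

end DH

namespace DH
variable {n : ℕ}

lemma exp_add_exp_neg (y : ℝ) : 2 + y ^ 2 ≤ Real.exp y + Real.exp (-y) := by
  wlog h : 0 ≤ y generalizing y
  · have := this (-y) (by linarith)
    simp at this ⊢; linarith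
  have h1 := Real.quadratic_le_exp_of_nonneg (x := y / 2) (by positivity)
  have h2 : Real.exp y = Real.exp (y / 2) ^ 2 := by rw [← Real.exp_nat_mul]; congr 1; push_cast; ring
  have h3 : Real.exp (-y) = (Real.exp (y / 2) ^ 2)⁻¹ := by rw [Real.exp_neg, h2]
  have h4 : y ≤ Real.exp (y / 2) - (Real.exp (y / 2))⁻¹ := by
    have := Real.self_le_sinh_iff.2 (show 0 ≤ y / 2 by positivity)
    rw [Real.sinh_eq, Real.exp_neg] at this
    linarith
  have h5 : Real.exp y + Real.exp (-y) = 2 + (Real.exp (y / 2) - (Real.exp (y / 2))⁻¹) ^ 2 := by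
    rw [h2, h3]
    have := Real.exp_pos (y / 2)
    field_simp
    ring
  rw [h5]
  gcongr

lemma phi_dd {β : ℝ} (hβ : 0 < β) (hβ2 : β ≤ 1 / 2) (c x : Zn n) (i : Fin n) :
    Real.exp (-β * sq (x - c)) * (2 * β * (β * ((x - c) i : ℝ) ^ 2 - 1)) ≤
      dd (fun x => Real.exp (-β * sq (x - c))) x i := by
  set t : ℝ := ((x - c) i : ℝ) with ht
  have e1 : Real.exp (-β * sq (x + ee i - c)) =
      Real.exp (-β * sq (x - c)) * (Real.exp (-β) * Real.exp (-(2 * β * t))) := by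
    rw [show x + ee i - c = (x - c) + ee i by abel, sq_add, ← Real.exp_add, ← Real.exp_add]
    congr 1; ring
  have e2 : Real.exp (-β * sq (x - ee i - c)) =
      Real.exp (-β * sq (x - c)) * (Real.exp (-β) * Real.exp (2 * β * t)) := by
    rw [show x - ee i - c = (x - c) - ee i by abel, sq_sub, ← Real.exp_add, ← Real.exp_add]
    congr 1; ring
  simp only [dd]
  rw [e1, e2]
  have h1 := exp_add_exp_neg (2 * β * t)
  have h2 := Real.add_one_le_exp (-β)
  have h3 : (1 - β) * (2 + (2 * β * t) ^ 2) ≤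
      Real.exp (-β) * (Real.exp (2 * β * t) + Real.exp (-(2 * β * t))) := by
    apply mul_le_mul _ h1 (by positivity) (Real.exp_pos _).le
    linarith
  have h4 : 2 * β * (β * t ^ 2 - 1) ≤ (1 - β) * (2 + (2 * β * t) ^ 2) - 2 := by
    have : 0 ≤ (1 / 2 - β) * (β * t) ^ 2 := mul_nonneg (by linarith) (by positivity)
    nlinarith
  have h5 := mul_le_mul_of_nonneg_left (h4.trans (sub_le_sub_right h3 2))
    (Real.exp_pos (-β * sq (x - c))).le
  linarith

lemma barrier {l L : ℝ} (hl : 0 < l) (hlL : l ≤ L) {β : ℝ} (hβ : 0 < β) (hβ2 : β ≤ 1 / 2)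
    (r R : ℕ) (hβr : n * L / l ≤ β * (r : ℝ) ^ 2) (u : Zn n → ℝ) (c : Zn n)
    (hu : ∀ x ∈ D c (R : ℤ), 0 ≤ u x ∧ S l L u x)
    (hr : ∀ x ∈ D c (r : ℤ), 1 ≤ u x) (x : Zn n) (hx : x ∈ D c (R : ℤ)) :
    Real.exp (-β * sq (x - c)) - Real.exp (-β * (R : ℝ) ^ 2) ≤ u x := by
  classical
  obtain ⟨z, hz, hmin⟩ := Finset.exists_min_image (D c (R : ℤ))
    (fun x => u x - Real.exp (-β * sq (x - c))) ⟨x, hx⟩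
  suffices h : 0 ≤ u z - Real.exp (-β * sq (z - c)) + Real.exp (-β * (R : ℝ) ^ 2) by
    have := hmin x hx
    linarith
  by_contra! hneg
  have huz := (hu z hz).1
  -- not in inner cube
  have hz1 : z ∉ D c (r : ℤ) := by
    intro h
    have h1 := hr z h
    have h2 : Real.exp (-β * sq (z - c)) ≤ 1 := by
      apply Real.exp_le_one_iff.2
      have := mul_nonneg hβ.le (sq_nonneg' (z - c))
      linarith
    have := Real.exp_pos (-β * (R : ℝ) ^ 2)
    linarith
  -- in the interior
  have hz2 : z ∈ D c ((R : ℤ) - 1) := by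
    by_contra h
    rw [mem_D] at h
    push Not at h
    obtain ⟨i, hi⟩ := h
    have hzi := mem_D.1 hz i
    have h1 : (R : ℝ) ^ 2 ≤ ((z - c) i : ℝ) ^ 2 := by
      have : (R : ℤ) ^ 2 ≤ ((z - c) i) ^ 2 := by
        simp only [Pi.sub_apply]
        by_cases h3 : c i - (R - 1) ≤ z i
        · have := hi h3
          have : z i - c i = R := by omega
          rw [this]
        · have : z i - c i = - R := by omega
          rw [this, neg_sq]
      exact_mod_cast this
    have h2 : Real.exp (-β * sq (z - c)) ≤ Real.exp (-β * (R : ℝ) ^ 2) := by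
      apply Real.exp_le_exp.2
      have := mul_le_mul_of_nonneg_left (h1.trans (le_sq (z - c) i)) hβ.le
      linarith
    linarith
  have hsq : (r : ℝ) ^ 2 < sq (z - c) := by
    rw [mem_D] at hz1
    push Not at hz1
    obtain ⟨i, hi⟩ := hz1
    refine lt_of_lt_of_le ?_ (le_sq (z - c) i)
    have : (r : ℤ) ^ 2 < ((z - c) i) ^ 2 := by
      rw [sq_lt_sq]
      rw [lt_abs, abs_of_nonneg (by positivity)]
      simp only [Pi.sub_apply]
      by_cases h3 : c i - r ≤ z i
      · have := hi h3; left; omega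
      · right; omega
    exact_mod_cast this
  obtain ⟨a, ha, hs⟩ := (hu z hz).2
  have h1 : ∀ i, dd (fun x => Real.exp (-β * sq (x - c))) z i ≤ dd u z i := by
    intro i
    have h1 := hmin _ (add_mem_D hz2 (by omega) i)
    have h2 := hmin _ (sub_mem_D hz2 (by omega) i)
    simp only [dd]
    linarith
  have h2 : ∑ i, a i * (Real.exp (-β * sq (z - c)) * (2 * β * (β * ((z - c) i : ℝ) ^ 2 - 1))) ≤ 0 := by
    refine le_trans (Finset.sum_le_sum fun i _ => ?_) hs
    exact mul_le_mul_of_nonneg_left ((phi_dd hβ hβ2 c z i).trans (h1 i)) (hl.le.trans (ha i).1)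
  have h3 : ∑ i, a i * (Real.exp (-β * sq (z - c)) * (2 * β * (β * ((z - c) i : ℝ) ^ 2 - 1)))
      = Real.exp (-β * sq (z - c)) * (2 * β) *
        (β * ∑ i, a i * ((z - c) i : ℝ) ^ 2 - ∑ i, a i) := by
    rw [Finset.mul_sum, ← Finset.sum_sub_distrib, Finset.mul_sum]
    exact Finset.sum_congr rfl fun j _ => by ring
  rw [h3] at h2
  have h4 : ∑ j, a j ≤ n * L := by
    have : ∑ j, a j ≤ ∑ j : Fin n, L := Finset.sum_le_sum fun j _ => (ha j).2
    simpa using this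
  have h5 : l * sq (z - c) ≤ ∑ i, a i * ((z - c) i : ℝ) ^ 2 := by
    rw [sq, Finset.mul_sum]
    exact Finset.sum_le_sum fun j _ => mul_le_mul_of_nonneg_right (ha j).1 (sq_nonneg _)
  have h6 : n * L < β * (l * sq (z - c)) := by
    rw [div_le_iff₀ hl] at hβr
    have := mul_lt_mul_of_pos_left hsq (mul_pos hβ hl)
    linarith
  have h7 : 0 < β * ∑ i, a i * ((z - c) i : ℝ) ^ 2 - ∑ i, a i := by
    have := mul_le_mul_of_nonneg_left h5 hβ.le
    linarith
  have := mul_pos (mul_pos (Real.exp_pos (-β * sq (z - c))) (show 0 < 2 * β by positivity)) h7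
  linarith

lemma nbr {l L : ℝ} (hl : 0 < l) (hlL : l ≤ L) (u : Zn n → ℝ) (y : Zn n) (hy : 0 ≤ u y)
    (hS : S l L u y) (hn : ∀ i, 0 ≤ u (y + ee i) ∧ 0 ≤ u (y - ee i)) (i : Fin n) :
    u (y + ee i) ≤ 2 * n * L / l * u y ∧ u (y - ee i) ≤ 2 * n * L / l * u y := by
  obtain ⟨a, ha, hs⟩ := hS
  have e : ∑ j, a j * dd u y j = ∑ j, a j * (u (y + ee j) + u (y - ee j)) - 2 * u y * ∑ j, a j := by
    rw [Finset.mul_sum, ← Finset.sum_sub_distrib]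
    exact Finset.sum_congr rfl fun j _ => by simp only [dd]; ring
  have h4 : ∑ j, a j ≤ n * L := by
    have : ∑ j, a j ≤ ∑ j : Fin n, L := Finset.sum_le_sum fun j _ => (ha j).2
    simpa using this
  have h5 := mul_le_mul_of_nonneg_left h4 (show 0 ≤ 2 * u y by positivity)
  have h2 : a i * (u (y + ee i) + u (y - ee i)) ≤ ∑ j, a j * (u (y + ee j) + u (y - ee j)) :=
    Finset.single_le_sum (f := fun j => a j * (u (y + ee j) + u (y - ee j)))
      (fun j _ => mul_nonneg (hl.le.trans (ha j).1) (add_nonneg (hn j).1 (hn j).2)) (Finset.mem_univ i)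
  have h3 := mul_le_mul_of_nonneg_right (ha i).1 (add_nonneg (hn i).1 (hn i).2)
  have h6 : u (y + ee i) + u (y - ee i) ≤ 2 * n * L / l * u y := by
    rw [div_mul_eq_mul_div, le_div_iff₀ hl]; linarith
  exact ⟨by linarith [(hn i).2], by linarith [(hn i).1]⟩

lemma chain {l L : ℝ} (hl : 0 < l) (hlL : l ≤ L) (H : ℝ) (hH1 : 1 ≤ H) (hH : 2 * n * L / l ≤ H)
    (u : Zn n → ℝ) (p : Zn n) (R : ℕ)
    (hu : ∀ x ∈ D p ((R + 1 : ℕ) : ℤ), 0 ≤ u x ∧ S l L u x) :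
    ∀ (m : ℕ) (x y : Zn n), x ∈ D p (R : ℤ) → y ∈ D p (R : ℤ) → ∑ i, (x i - y i).natAbs = m →
      u x ≤ H ^ m * u y := by
  classical
  have mono : ∀ z ∈ D p (R : ℤ), z ∈ D p ((R + 1 : ℕ) : ℤ) := by
    intro z hz; rw [mem_D] at *; intro i; have := hz i; push_cast; constructor <;> omega
  have step : ∀ y ∈ D p (R : ℤ), ∀ i, u (y + ee i) ≤ H * u y ∧ u (y - ee i) ≤ H * u y := by
    intro y hy i
    have h0 := hu y (mono y hy)
    have h := nbr hl hlL u y h0.1 h0.2 (fun i => ⟨(hu _ (add_mem_D hy (by push_cast; omega) i)).1,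
      (hu _ (sub_mem_D hy (by push_cast; omega) i)).1⟩) i
    have := mul_le_mul_of_nonneg_right hH h0.1
    exact ⟨h.1.trans this, h.2.trans this⟩
  intro m
  induction m with
  | zero =>
    intro x y _ _ h
    have : x = y := by
      funext i
      have := (Finset.sum_eq_zero_iff.1 h) i (Finset.mem_univ i)
      omega
    simp [this]
  | succ m ih =>
    intro x y hx hy h
    have : ∃ i, x i ≠ y i := by
      by_contra! hc
      simp [hc] at h
    obtain ⟨i, hi⟩ := this
    have hxi := mem_D.1 hx i
    have hyi := mem_D.1 hy i
    have hsum : ∀ z : Zn n, (∀ j, j ≠ i → z j = y j) →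
        (x i - z i).natAbs + 1 = (x i - y i).natAbs → ∑ j, (x j - z j).natAbs = m := by
      intro z hz hzi
      have e1 := Finset.add_sum_erase Finset.univ (fun j => (x j - y j).natAbs) (Finset.mem_univ i)
      have e2 := Finset.add_sum_erase Finset.univ (fun j => (x j - z j).natAbs) (Finset.mem_univ i)
      have e3 : ∑ j ∈ Finset.univ.erase i, (x j - z j).natAbs =
          ∑ j ∈ Finset.univ.erase i, (x j - y j).natAbs :=
        Finset.sum_congr rfl fun j hj => by rw [hz j (Finset.ne_of_mem_erase hj)]
      omega
    have hmem : ∀ z : Zn n, (∀ j, j ≠ i → z j = y j) → (p i - R ≤ z i ∧ z i ≤ p i + R) →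
        z ∈ D p (R : ℤ) := by
      intro z hz hzi
      rw [mem_D]
      intro j
      by_cases hj : j = i
      · subst hj; exact hzi
      · rw [hz j hj]; exact mem_D.1 hy j
    have hHm : 0 ≤ H ^ m := by positivity
    rcases lt_or_gt_of_ne hi with hlt | hgt
    · have a1 : ∀ j, j ≠ i → (y - ee i) j = y j := fun j hj => by simp [ee_ne hj]
      have a2 : (y - ee i) i = y i - 1 := by simp [ee_same]
      have := ih x (y - ee i) hx (hmem _ a1 (by rw [a2]; omega)) (hsum _ a1 (by rw [a2]; omega))
      refine this.trans ?_
      rw [pow_succ, mul_assoc]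
      exact mul_le_mul_of_nonneg_left (step y hy i).2 hHm
    · have a1 : ∀ j, j ≠ i → (y + ee i) j = y j := fun j hj => by simp [ee_ne hj]
      have a2 : (y + ee i) i = y i + 1 := by simp [ee_same]
      have := ih x (y + ee i) hx (hmem _ a1 (by rw [a2]; omega)) (hsum _ a1 (by rw [a2]; omega))
      refine this.trans ?_
      rw [pow_succ, mul_assoc]
      exact mul_le_mul_of_nonneg_left (step y hy i).1 hHm

end DH

namespace DH
variable {n : ℕ}

/-- dyadic cube -/
def Q (k : ℕ) (z : Zn n) : Finset (Zn n) :=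
  Finset.Icc (fun i => 2 ^ k * z i) (fun i => 2 ^ k * z i + 2 ^ k - 1)

lemma mem_Q {k : ℕ} {z x : Zn n} : x ∈ Q k z ↔ ∀ i, 2 ^ k * z i ≤ x i ∧ x i < 2 ^ k * z i + 2 ^ k := by
  simp only [Q, Finset.mem_Icc, Pi.le_def]
  exact ⟨fun h i => ⟨h.1 i, by have := h.2 i; omega⟩,
    fun h => ⟨fun i => (h i).1, fun i => by have := (h i).2; omega⟩⟩

lemma mem_Q' {k : ℕ} {z x : Zn n} : x ∈ Q k z ↔ (fun i => x i / 2 ^ k) = z := by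
  rw [mem_Q, funext_iff]
  refine forall_congr' fun i => ?_
  have : (0 : ℤ) < 2 ^ k := by positivity
  rw [Int.ediv_eq_iff_of_pos this]
  constructor <;> intro h <;> constructor <;> nlinarith [h.1, h.2]

lemma card_Q (k : ℕ) (z : Zn n) : (Q k z).card = (2 ^ k) ^ n := by
  simp only [Q, Pi.card_Icc, Int.card_Icc]
  have : ∀ i : Fin n, (2 ^ k * z i + 2 ^ k - 1 + 1 - 2 ^ k * z i).toNat = 2 ^ k := fun i => by
    rw [show (2 ^ k * z i + 2 ^ k - 1 + 1 - 2 ^ k * z i) = ((2 ^ k : ℕ) : ℤ) by push_cast; ring]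
    exact Int.toNat_natCast _
  simp only [this]
  simp

lemma cz (A B : Zn n → Prop) [DecidablePred A] [DecidablePred B] (μ : ℝ) (hμ : 0 < μ) (hμ1 : μ ≤ 1) (K : ℕ)
    (h : ∀ k < K, ∀ z : Zn n, (1 - μ) * (2 ^ k) ^ n < ((Q k z).filter A).card →
      ∀ x ∈ Q (k + 1) (fun i => z i / 2), B x) :
    ∀ k ≤ K, ∀ z : Zn n, (1 - μ) * (2 ^ k) ^ n < ((Q k z).filter A).card ∨
      (((Q k z).filter A).card : ℝ) ≤ (1 - μ) * ((Q k z).filter B).card := by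
  intro k
  induction k with
  | zero =>
    intro _ z
    rcases Finset.eq_empty_or_nonempty ((Q 0 z).filter A) with he | hne
    · right; rw [he]; simp
      exact mul_nonneg (by linarith) (by positivity)
    · left
      have : (1 : ℝ) ≤ ((Q 0 z).filter A).card := by exact_mod_cast hne.card_pos
      simp only [pow_zero, one_pow]
      linarith
  | succ k ih =>
    intro hk z
    have part : ∀ (P : Zn n → Prop) [DecidablePred P], ((Q (k + 1) z).filter P).card =
        ∑ w ∈ (Finset.Icc (fun i => 2 * z i) (fun i => 2 * z i + 1) : Finset (Zn n)),
          ((Q k w).filter P).card := by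
      intro P _
      rw [Finset.card_eq_sum_card_fiberwise (f := fun x : Zn n => fun i => x i / 2 ^ k)
        (t := (Finset.Icc (fun i => 2 * z i) (fun i => 2 * z i + 1) : Finset (Zn n)))]
      · refine Finset.sum_congr rfl fun w hw => ?_
        congr 1
        ext x
        simp only [Finset.mem_filter, ← mem_Q']
        constructor
        · rintro ⟨⟨_, h2⟩, h3⟩; exact ⟨h3, h2⟩
        · rintro ⟨h3, h2⟩
          refine ⟨⟨?_, h2⟩, h3⟩
          rw [mem_Q'] at h3 ⊢
          rw [Finset.mem_Icc] at hw
          funext i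
          have e1 : x i / 2 ^ k = w i := congrFun h3 i
          have e2 := hw.1 i
          have e3 := hw.2 i
          simp only at e2 e3
          rw [pow_succ, ← Int.ediv_ediv_of_nonneg (by positivity), e1]
          omega
      · intro x hx
        simp only [Finset.coe_filter, Set.mem_ofPred_eq] at hx
        have h3 := hx.1
        rw [mem_Q'] at h3
        simp only [Finset.coe_Icc, Set.mem_Icc, Pi.le_def]
        have : ∀ i, x i / 2 ^ k / 2 = z i := fun i => by
          rw [Int.ediv_ediv_of_nonneg (by positivity), ← pow_succ]
          exact congrFun h3 i
        exact ⟨fun i => by have := this i; omega, fun i => by have := this i; omega⟩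
    by_cases hc : ∃ w ∈ (Finset.Icc (fun i => 2 * z i) (fun i => 2 * z i + 1) : Finset (Zn n)),
        (1 - μ) * (2 ^ k) ^ n < ((Q k w).filter A).card
    · obtain ⟨w, hw, hw2⟩ := hc
      have h1 := h k (by omega) w hw2
      have h2 : (fun i => w i / 2) = z := by
        rw [Finset.mem_Icc] at hw
        funext i
        have e2 := hw.1 i
        have e3 := hw.2 i
        simp only at e2 e3
        omega
      rw [h2] at h1
      rw [Finset.filter_true_of_mem (p := B) h1, card_Q]
      push_cast
      exact lt_or_ge _ _
    · right
      push Not at hc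
      rw [part A, part B]
      push_cast
      rw [Finset.mul_sum]
      refine Finset.sum_le_sum fun w hw => ?_
      rcases ih (by omega) w with h1 | h1
      · exact absurd h1 (not_lt.2 (hc w hw))
      · exact h1

lemma D_mono {c c2 : Zn n} {R R' : ℤ} (h : ∀ i, |c i - c2 i| + R ≤ R') {x : Zn n} (hx : x ∈ D c R) :
    x ∈ D c2 R' := by
  rw [mem_D] at *
  intro i
  have h1 := hx i
  have h2 := h i
  have h3 := abs_le.1 (le_refl |c i - c2 i|)
  constructor <;> linarith [h3.1, h3.2]

/-- Measure estimate at large scales. -/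
lemma meas_large {l L : ℝ} (hl : 0 < l) (hlL : l ≤ L) (K : ℕ) (hK : n * L / l + 1 ≤ K)
    (N' r : ℕ) (hN : n + 3 < N') (hr : 1 ≤ r) (α c0 : ℝ) (hα : α = n * L / l + 1)
    (hαr : 2 * α ≤ (r : ℝ) ^ 2)
    (hc0 : c0 = Real.exp (-α * (n * (6 * N') ^ 2)) - Real.exp (-α * ((n + 1) * (6 * N')) ^ 2))
    (u : Zn n → ℝ) (p : Zn n)
    (hu : ∀ x ∈ D p ((((n + 1) * 6 * N' + 2 * N') * r : ℕ) : ℤ), 0 ≤ u x ∧ S l L u x)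
    (hx : ∃ x ∈ D p ((2 * (2 * N' * r) : ℕ) : ℤ), u x ≤ 1) :
    (2 * r + 1) ^ n ≤ (2 * K + 1) ^ n *
      ((D (fun i => p i + N' * r) ((N' * r - 1 : ℤ))).filter (fun x => u x ≤ (n + 1) * (2 / c0))).card := by
  have hr0 : (0 : ℝ) < r := by exact_mod_cast hr
  have hN0 : (0 : ℝ) < N' := by exact_mod_cast (by omega : 0 < N')
  have hα0 : 0 < α := by
    rw [hα]; have : 0 ≤ n * L / l := by have := hl.le.trans hlL; positivity
    linarith
  have hc0pos : 0 < c0 := by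
    rw [hc0, sub_pos]
    apply Real.exp_lt_exp.2
    have : (0 : ℝ) ≤ n := by positivity
    have : (n : ℝ) * (6 * N') ^ 2 < ((n + 1) * (6 * N')) ^ 2 := by
      rw [mul_pow (n + 1 : ℝ)]
      apply mul_lt_mul_of_pos_right _ (by positivity)
      nlinarith
    nlinarith
  set c : Zn n := fun i => p i + N' * r with hc
  have hNr : (1 : ℤ) ≤ N' * r := by
    have : 1 ≤ N' * r := Nat.mul_pos (by omega) (by omega)
    exact_mod_cast this
  have hnr : ((n : ℤ) + 4) * r ≤ N' * r := by
    have : (n + 4) * r ≤ N' * r := Nat.mul_le_mul_right r (by omega)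
    exact_mod_cast this
  have hr1 : (1 : ℤ) ≤ r := by exact_mod_cast hr
  have hnn : (0 : ℤ) ≤ n * (N' * r) := by positivity
  have hcp : ∀ i, |c i - p i| = (N' * r : ℤ) := fun i => by
    rw [hc]; simp only [add_sub_cancel_left]; exact abs_of_nonneg (by positivity)
  -- point in the inner cube
  have h1 : ∃ x1 ∈ D c (r : ℤ), u x1 ≤ 2 / c0 := by
    by_contra! hcon
    obtain ⟨x, hx, hx1⟩ := hx
    have hb := barrier hl hlL (β := α / (r : ℝ) ^ 2) (by positivity)
      (by rw [div_le_iff₀ (by positivity)]; linarith) r ((n + 1) * 6 * N' * r)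
      (by rw [div_mul_cancel₀ _ (by positivity)]; linarith) (fun y => c0 / 2 * u y) c
      (by
        intro y hy
        have := hu y (D_mono (fun i => by rw [hcp]; push_cast; nlinarith) hy)
        exact ⟨mul_nonneg (by positivity) this.1, S_smul this.2 (by positivity)⟩)
      (by
        intro y hy
        have h3 := hcon y hy
        rw [div_lt_iff₀ hc0pos] at h3
        linarith) x (D_mono (fun i => by rw [abs_sub_comm, hcp]; push_cast; nlinarith) hx)
    have hsq : sq (x - c) ≤ n * ((6 * N' * r : ℝ)) ^ 2 := by
      apply sq_le
      intro i
      have h3 := mem_D.1 hx i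
      have : |(x - c) i| ≤ (6 * N' * r : ℤ) := by
        rw [abs_le]
        simp only [Pi.sub_apply, hc]
        push_cast at h3
        constructor <;> nlinarith
      exact_mod_cast this
    have e1 : -α * (n * (6 * N') ^ 2) ≤ -(α / (r : ℝ) ^ 2) * sq (x - c) := by
      have := mul_le_mul_of_nonneg_left hsq (show 0 ≤ α / (r : ℝ) ^ 2 by positivity)
      have e : α / (r : ℝ) ^ 2 * (n * ((6 * N' * r : ℝ)) ^ 2) = α * (n * (6 * N') ^ 2) := by
        field_simp
      linarith
    have e2 : -(α / (r : ℝ) ^ 2) * (((n + 1) * 6 * N' * r : ℕ) : ℝ) ^ 2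
        = -α * ((n + 1) * (6 * N')) ^ 2 := by
      push_cast; field_simp
    rw [e2] at hb
    have := Real.exp_le_exp.2 e1
    have h5 : c0 ≤ c0 / 2 * u x := by linarith
    nlinarith
  obtain ⟨x1, hx1, hux1⟩ := h1
  have hsl := slide hl hlL K hK (fun y => c0 / 2 * u y) x1 r hr ?_ ?_
  · refine hsl.trans (Nat.mul_le_mul_left _ (Finset.card_le_card ?_))
    intro x hx
    rw [Finset.mem_filter] at hx ⊢
    refine ⟨?_, ?_⟩
    · have h3 := mem_D.1 hx.1
      have h4 := mem_D.1 hx1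
      rw [mem_D]
      intro i
      have h3 := h3 i
      have h4 := h4 i
      push_cast at h3
      constructor <;> nlinarith
    · have h3 := hx.2
      rw [mul_div_assoc', le_div_iff₀ hc0pos]
      linarith
  · intro y hy
    have h3 : y ∈ D p ((((n + 1) * 6 * N' + 2 * N') * r : ℕ) : ℤ) := by
      have h3 := mem_D.1 hy
      have h4 := mem_D.1 hx1
      rw [mem_D]
      intro i
      have h3 := h3 i
      have h4 := h4 i
      simp only [hc] at h4
      push_cast at h3 ⊢
      constructor <;> nlinarith
    have := hu y h3
    exact ⟨mul_nonneg (by positivity) this.1, S_smul this.2 (by positivity)⟩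
  · rw [le_div_iff₀ hc0pos] at hux1
    linarith

end DH

namespace DH
variable {n : ℕ}

lemma meas (n : ℕ) {l L : ℝ} (hl : 0 < l) (hlL : l ≤ L) :
    ∃ (μ M : ℝ) (κ : ℕ), 0 < μ ∧ μ ≤ 1 ∧ 1 ≤ M ∧ 1 ≤ κ ∧ ∀ (k : ℕ) (p : Zn n) (z : Zn n) (u : Zn n → ℝ),
      (p = fun i => 2 ^ k * z i) →
      (∀ x ∈ D p ((κ * 2 ^ k : ℕ) : ℤ), 0 ≤ u x ∧ S l L u x) →
      (∃ x ∈ D p ((2 * 2 ^ k : ℕ) : ℤ), u x ≤ 1) →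
      μ * (2 ^ k) ^ n ≤ ((Q k z).filter (fun x => u x ≤ M)).card := by
  set K : ℕ := ⌈n * L / l + 1⌉₊ with hKdef
  have hK : n * L / l + 1 ≤ K := Nat.le_ceil _
  set N' : ℕ := 2 ^ (n + 3) with hN'
  have hN : n + 3 < N' := Nat.lt_two_pow_self
  set α : ℝ := n * L / l + 1 with hα
  set c0 : ℝ := Real.exp (-α * (n * (6 * N') ^ 2)) - Real.exp (-α * ((n + 1) * (6 * N')) ^ 2) with hc0
  obtain ⟨k1, hk1⟩ := pow_unbounded_of_one_lt (2 * α) (one_lt_two)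
  set H : ℝ := max 1 (2 * n * L / l) with hH
  have hH1 : 1 ≤ H := le_max_left _ _
  set kk := k1 + (n + 4) with hkk
  set M2 : ℝ := H ^ (n * (4 * 2 ^ kk)) with hM2
  have hM2' : 1 ≤ M2 := one_le_pow₀ hH1
  set M1 : ℝ := (n + 1) * (2 / c0) with hM1
  set W : ℕ := 2 * N' * (2 * K + 1) with hW
  have hW1 : 1 ≤ W := Nat.mul_pos (by omega) (by omega)
  have hWr : (0 : ℝ) < W := by exact_mod_cast hW1
  refine ⟨1 / (W : ℝ) ^ n, max M1 M2, 3 * (n + 1) + 1 + 3, by positivity, ?_, hM2'.trans (le_max_right _ _), by omega, ?_⟩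
  · rw [div_le_one (by positivity)]
    exact one_le_pow₀ (by exact_mod_cast hW1)
  intro k p z u hp hu hx
  by_cases hk : k < kk
  · -- small scales
    have hall : ∀ x ∈ Q k z, u x ≤ max M1 M2 := by
      intro y hy
      obtain ⟨x, hx, hx1⟩ := hx
      have hpos : (1 : ℤ) ≤ 2 ^ k := by exact_mod_cast Nat.one_le_two_pow
      have hch := chain hl hlL H hH1 (le_max_right _ _) u p (2 * 2 ^ k) (by
          intro x hx
          apply hu x
          apply D_mono _ hx
          intro i
          simp only [sub_self, abs_zero, zero_add]
          push_cast
          nlinarith [show (0 : ℤ) ≤ n * 2 ^ k by positivity])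
        _ y x (by
          rw [mem_Q] at hy
          rw [mem_D]; intro i
          have := hy i
          rw [hp]; push_cast
          constructor <;> linarith) hx rfl
      have hle : ∑ i, (y i - x i).natAbs ≤ n * (4 * 2 ^ kk) := by
        have : ∑ i, (y i - x i).natAbs ≤ ∑ i : Fin n, 4 * 2 ^ kk := by
          refine Finset.sum_le_sum fun i _ => ?_
          rw [mem_Q] at hy
          have h1 := hy i
          have h2 := mem_D.1 hx i
          rw [hp] at h2
          push_cast at h2
          have h3 : (2 : ℤ) ^ k ≤ 2 ^ kk := pow_le_pow_right₀ (by norm_num) hk.le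
          have h4 : ((4 * 2 ^ kk : ℕ) : ℤ) = 4 * 2 ^ kk := by push_cast; ring
          have h5 : |y i - x i| ≤ ((4 * 2 ^ kk : ℕ) : ℤ) := by
            rw [h4, abs_le]
            constructor <;> linarith
          omega
        simpa using this
      have hux : 0 ≤ u x := (hu x (by
          apply D_mono _ hx
          intro i
          simp only [sub_self, abs_zero, zero_add]
          push_cast
          nlinarith [show (0 : ℤ) ≤ n * 2 ^ k by positivity])).1
      calc u y ≤ H ^ _ * u x := hch
        _ ≤ M2 * 1 := by
            apply mul_le_mul _ hx1 hux (by positivity)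
            exact pow_le_pow_right₀ hH1 hle
        _ ≤ max M1 M2 := by rw [mul_one]; exact le_max_right _ _
    rw [Finset.filter_true_of_mem hall, card_Q]
    push_cast
    have : 1 / (W : ℝ) ^ n ≤ 1 := by
      rw [div_le_one (by positivity)]
      exact one_le_pow₀ (by exact_mod_cast hW1)
    have h2 : (0 : ℝ) ≤ (2 ^ k) ^ n := by positivity
    nlinarith
  · push Not at hk
    obtain ⟨j, hj⟩ : ∃ j, k = j + (n + 4) := ⟨k - (n + 4), by omega⟩
    have hjk : k1 ≤ j := by omega
    set r : ℕ := 2 ^ j with hr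
    have hr1 : 1 ≤ r := Nat.one_le_two_pow
    have hs : 2 ^ k = 2 * N' * r := by rw [hj, hN', hr]; ring
    have hαr : 2 * α ≤ (r : ℝ) ^ 2 := by
      have h1 : (2 : ℝ) ^ k1 ≤ r := by
        rw [hr]; push_cast; exact pow_le_pow_right₀ (by norm_num) hjk
      have h2 : (1 : ℝ) ≤ r := by exact_mod_cast hr1
      nlinarith
    have hm := meas_large hl hlL K hK N' r hN hr1 α c0 hα hαr hc0 u p (by
        intro x hx
        apply hu x
        apply D_mono _ hx
        intro i
        simp only [sub_self, abs_zero, zero_add]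
        rw [hs]
        push_cast
        nlinarith [show (0 : ℤ) ≤ n * (N' * r) by positivity, show (0 : ℤ) ≤ (N' * r) by positivity]) (by
        rw [← hs]; exact hx)
    have hsub : ((D (fun i => p i + N' * r) ((N' * r - 1 : ℤ))).filter (fun x => u x ≤ (n + 1) * (2 / c0))).card
        ≤ ((Q k z).filter (fun x => u x ≤ max M1 M2)).card := by
      apply Finset.card_le_card
      intro x hx
      rw [Finset.mem_filter] at hx ⊢
      refine ⟨?_, hx.2.trans (le_max_left _ _)⟩
      have h1 := mem_D.1 hx.1
      rw [mem_Q]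
      intro i
      have h1 := h1 i
      rw [hp] at h1
      have hs' : (2 : ℤ) ^ k = 2 * N' * r := by exact_mod_cast hs
      simp only [hs'] at h1 ⊢
      constructor <;> linarith
    have h2 : ((2 * r + 1) ^ n : ℝ) ≤ (2 * K + 1) ^ n * ((Q k z).filter (fun x => u x ≤ max M1 M2)).card := by
      exact_mod_cast hm.trans (Nat.mul_le_mul_left _ hsub)
    have hs' : (2 : ℝ) ^ k = 2 * N' * r := by exact_mod_cast hs
    rw [hs', div_mul_eq_mul_div, one_mul, div_le_iff₀ (by positivity), hW]
    push_cast
    rw [mul_pow, mul_pow (2 * (N' : ℝ)) (2 * K + 1)]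
    have h3 : (r : ℝ) ^ n ≤ (2 * r + 1) ^ n := by
      apply pow_le_pow_left₀ (by positivity)
      have : (0 : ℝ) ≤ r := by positivity
      linarith
    have h4 := mul_le_mul_of_nonneg_left (h3.trans h2) (show (0 : ℝ) ≤ (2 * N') ^ n by positivity)
    linarith

lemma weak (n : ℕ) {l L : ℝ} (hl : 0 < l) (hlL : l ≤ L) :
    ∃ (θ : ℝ) (κ : ℕ), 0 < θ ∧ θ ≤ 1 ∧ 1 ≤ κ ∧ ∀ (K : ℕ) (u : Zn n → ℝ),
      (∀ x ∈ D 0 ((κ * 2 ^ K : ℕ) : ℤ), 0 ≤ u x ∧ S l L u x) →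
      (∃ x ∈ D 0 ((2 ^ K : ℕ) : ℤ), u x ≤ θ) →
      (((Q K (0 : Zn n)).filter (fun x => 1 < u x)).card : ℝ) < 1 / 2 * (2 ^ K) ^ n := by
  obtain ⟨μ, M, κ, hμ, hμ1, hM, hκ, hmeas⟩ := meas n hl hlL
  obtain ⟨j0, hj0⟩ := exists_pow_lt_of_lt_one (show (0 : ℝ) < 1 / 2 by norm_num) (show 1 - μ < 1 by linarith)
  have hM0 : 0 < M := by linarith
  refine ⟨1 / M ^ j0, κ + 1, by positivity, ?_, by omega, ?_⟩
  · rw [div_le_one (by positivity)]; exact one_le_pow₀ hM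
  intro K u hu hx
  have main : ∀ j : ℕ, ∀ v : Zn n → ℝ, (∀ x ∈ D 0 (((κ + 1) * 2 ^ K : ℕ) : ℤ), 0 ≤ v x ∧ S l L v x) →
      (∃ x ∈ D 0 ((2 ^ K : ℕ) : ℤ), v x ≤ 1) →
      (((Q K (0 : Zn n)).filter (fun x => M ^ j < v x)).card : ℝ) ≤ (1 - μ) ^ j * (2 ^ K) ^ n := by
    intro j v hv hvx
    -- scaled measure estimate
    have hm : ∀ k ≤ K, ∀ (z : Zn n) (i : ℕ), (∃ x ∈ Q k z, x ∈ Q K (0 : Zn n)) →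
        (∃ x ∈ D (fun i => 2 ^ k * z i) ((2 * 2 ^ k : ℕ) : ℤ), v x ≤ M ^ i) →
        (((Q k z).filter (fun x => M ^ (i + 1) < v x)).card : ℝ) ≤ (1 - μ) * (2 ^ k) ^ n := by
      intro k hk z i hz hx
      have hMi : 0 < M ^ i := by positivity
      have h := hmeas k _ z (fun x => 1 / M ^ i * v x) rfl (by
        intro x hx
        have hD : x ∈ D (0 : Zn n) (((κ + 1) * 2 ^ K : ℕ) : ℤ) := by
          apply D_mono _ hx
          intro m
          obtain ⟨y, hy1, hy2⟩ := hz
          have h1 := mem_Q.1 hy1 m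
          have h2 := mem_Q.1 hy2 m
          have h3 : (2 : ℤ) ^ k ≤ 2 ^ K := pow_le_pow_right₀ (by norm_num) hk
          simp only [Pi.zero_apply, mul_zero, zero_add, sub_zero] at h2 ⊢
          have h4 : |2 ^ k * z m| ≤ (2 : ℤ) ^ K := by rw [abs_le]; constructor <;> linarith
          push_cast
          have : (κ : ℤ) * 2 ^ k ≤ κ * 2 ^ K := by gcongr
          linarith
        have := hv x hD
        exact ⟨mul_nonneg (by positivity) this.1, S_smul this.2 (by positivity)⟩) (by
        obtain ⟨x, hx, hx1⟩ := hx
        refine ⟨x, hx, ?_⟩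
        rw [div_mul_eq_mul_div, one_mul, div_le_one hMi]; exact hx1)
      have h1 := Finset.card_filter_add_card_filter_not (s := Q k z) (fun x => 1 / M ^ i * v x ≤ M)
      rw [card_Q] at h1
      have h2 : (Q k z).filter (fun x => ¬ (1 / M ^ i * v x ≤ M)) = (Q k z).filter (fun x => M ^ (i + 1) < v x) := by
        apply Finset.filter_congr
        intro x _
        rw [not_le, div_mul_eq_mul_div, one_mul, lt_div_iff₀ hMi, pow_succ, mul_comm M]
      rw [h2] at h1
      have h3 : (((Q k z).filter (fun x => 1 / M ^ i * v x ≤ M)).card : ℝ) +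
        ((Q k z).filter (fun x => M ^ (i + 1) < v x)).card = (2 ^ k) ^ n := by exact_mod_cast h1
      linarith
    have hself : ∃ x ∈ Q K (0 : Zn n), x ∈ Q K (0 : Zn n) := ⟨0, by
      rw [mem_Q]; intro i; simp, by rw [mem_Q]; intro i; simp⟩
    have hbase : ∀ i : ℕ, (((Q K (0 : Zn n)).filter (fun x => M ^ (i + 1) < v x)).card : ℝ) ≤
        (1 - μ) * (2 ^ K) ^ n := by
      intro i
      apply hm K le_rfl 0 i hself
      obtain ⟨x, hx, hx1⟩ := hvx
      refine ⟨x, ?_, hx1.trans (one_le_pow₀ hM)⟩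
      apply D_mono _ hx
      intro m
      simp
    induction j with
    | zero =>
      have := Finset.card_filter_le (Q K (0 : Zn n)) (fun x => M ^ 0 < v x)
      rw [card_Q] at this
      rw [pow_zero (1 - μ), one_mul]
      exact_mod_cast this
    | succ j ih =>
      have h := cz (fun x => M ^ (j + 1) < v x ∧ x ∈ Q K (0 : Zn n)) (fun x => M ^ j < v x) μ hμ hμ1 K (by
        intro k hk z hcard x hx
        by_contra hcon
        have hne : ((Q k z).filter (fun x => M ^ (j + 1) < v x ∧ x ∈ Q K (0 : Zn n))).Nonempty := by
          rw [Finset.nonempty_iff_ne_empty]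
          intro he
          rw [he] at hcard
          simp at hcard
          have : 0 ≤ (1 - μ) * (2 ^ k) ^ n := mul_nonneg (by linarith) (by positivity)
          linarith
        obtain ⟨y, hy⟩ := hne
        rw [Finset.mem_filter] at hy
        have h2 := hm k hk.le z j ⟨y, hy.1, hy.2.2⟩ ⟨x, by
          rw [mem_Q] at hx
          rw [mem_D]
          intro i
          have h3 := hx i
          rw [pow_succ] at h3
          push_cast
          have h4 : z i ≤ 2 * (z i / 2) + 1 := by omega
          have h5 : 2 * (z i / 2) ≤ z i := by omega
          have h6 : (0 : ℤ) < 2 ^ k := by positivity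
          constructor <;> nlinarith, not_lt.1 hcon⟩
        have h3 : ((Q k z).filter (fun x => M ^ (j + 1) < v x ∧ x ∈ Q K (0 : Zn n))).card ≤
            ((Q k z).filter (fun x => M ^ (j + 1) < v x)).card := by
          apply Finset.card_le_card
          intro y hy
          rw [Finset.mem_filter] at hy ⊢
          exact ⟨hy.1, hy.2.1⟩
        have h4 : (((Q k z).filter (fun x => M ^ (j + 1) < v x ∧ x ∈ Q K (0 : Zn n))).card : ℝ) ≤
            ((Q k z).filter (fun x => M ^ (j + 1) < v x)).card := by exact_mod_cast h3
        linarith) K le_rfl 0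
      have e : (Q K (0 : Zn n)).filter (fun x => M ^ (j + 1) < v x ∧ x ∈ Q K (0 : Zn n)) =
          (Q K (0 : Zn n)).filter (fun x => M ^ (j + 1) < v x) := by
        apply Finset.filter_congr
        intro x hx
        simp [hx]
      rw [e] at h
      rcases h with h | h
      · exact absurd h (not_lt.2 (hbase j))
      · refine h.trans ?_
        rw [pow_succ, mul_comm ((1 - μ) ^ j), mul_assoc]
        exact mul_le_mul_of_nonneg_left ih (by linarith)
  have hMj : 0 < M ^ j0 := by positivity
  have h := main j0 (fun x => M ^ j0 * u x) (by
      intro x hx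
      have := hu x hx
      exact ⟨mul_nonneg (by positivity) this.1, S_smul this.2 (by positivity)⟩) (by
      obtain ⟨x, hx, hx1⟩ := hx
      refine ⟨x, hx, ?_⟩
      rw [le_div_iff₀ hMj] at hx1
      linarith)
  have e : (Q K (0 : Zn n)).filter (fun x => M ^ j0 < M ^ j0 * u x) =
      (Q K (0 : Zn n)).filter (fun x => 1 < u x) := by
    apply Finset.filter_congr
    intro x _
    rw [lt_mul_iff_one_lt_right hMj]
  rw [e] at h
  refine h.trans_lt ?_
  exact mul_lt_mul_of_pos_right hj0 (by positivity)

end DH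

namespace DH
variable {n : ℕ}

def Sol (l L : ℝ) (u : Zn n → ℝ) (x : Zn n) : Prop :=
  ∃ a : Fin n → ℝ, (∀ i, l ≤ a i ∧ a i ≤ L) ∧ ∑ i, a i * dd u x i = 0

lemma Sol.toS {l L : ℝ} {u : Zn n → ℝ} {x : Zn n} (h : Sol l L u x) (s t : ℝ) :
    S l L (fun y => s * u y + t) x := by
  obtain ⟨a, ha, hs⟩ := h
  refine ⟨a, ha, ?_⟩
  have : ∑ i, a i * dd (fun y => s * u y + t) x i = s * ∑ i, a i * dd u x i := by
    rw [Finset.mul_sum]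
    refine Finset.sum_congr rfl fun i _ => ?_
    simp only [dd]; ring
  rw [this, hs, mul_zero]

lemma osc_step (n : ℕ) {l L : ℝ} (hl : 0 < l) (hlL : l ≤ L) :
    ∃ (η : ℝ) (q : ℕ), 0 < η ∧ η < 1 ∧ 1 ≤ q ∧ ∀ (K : ℕ) (u : Zn n → ℝ) (m ω : ℝ), 0 < ω →
      (∀ x ∈ D 0 ((2 ^ (K + q) : ℕ) : ℤ), m ≤ u x ∧ u x ≤ m + ω ∧ Sol l L u x) →
      ∃ m', ∀ x ∈ D 0 ((2 ^ K : ℕ) : ℤ), m' ≤ u x ∧ u x ≤ m' + (1 - η) * ω := by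
  obtain ⟨θ, κ, hθ, hθ1, hκ, hw⟩ := weak n hl hlL
  refine ⟨θ / 3, κ, by positivity, by linarith, hκ, ?_⟩
  intro K u m ω hω hu
  have hsub : ∀ x ∈ D (0 : Zn n) ((κ * 2 ^ K : ℕ) : ℤ), x ∈ D (0 : Zn n) ((2 ^ (K + κ) : ℕ) : ℤ) := by
    intro x hx
    apply D_mono _ hx
    intro i
    simp only [sub_self, abs_zero, zero_add]
    have : κ * 2 ^ K ≤ 2 ^ (K + κ) := by
      rw [pow_add, mul_comm]
      exact Nat.mul_le_mul_left _ Nat.lt_two_pow_self.le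
    exact_mod_cast this
  have hsub2 : ∀ x ∈ D (0 : Zn n) ((2 ^ K : ℕ) : ℤ), x ∈ D (0 : Zn n) ((2 ^ (K + κ) : ℕ) : ℤ) := by
    intro x hx
    apply D_mono _ hx
    intro i
    simp only [sub_self, abs_zero, zero_add]
    have : 2 ^ K ≤ 2 ^ (K + κ) := Nat.pow_le_pow_right (by norm_num) (by omega)
    exact_mod_cast this
  have h1 := hw K (fun x => (3 / ω) * u x + (-(3 / ω) * m)) (fun x hx => by
    have := hu x (hsub x hx)
    refine ⟨?_, this.2.2.toS _ _⟩
    have h2 := mul_le_mul_of_nonneg_left this.1 (show 0 ≤ 3 / ω by positivity)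
    linarith)
  have h2 := hw K (fun x => (-(3 / ω)) * u x + ((3 / ω) * (m + ω))) (fun x hx => by
    have := hu x (hsub x hx)
    refine ⟨?_, this.2.2.toS _ _⟩
    have h2 := mul_le_mul_of_nonneg_left this.2.1 (show 0 ≤ 3 / ω by positivity)
    linarith)
  have e3 : 3 / ω * ω = 3 := by field_simp
  by_cases c1 : ∃ x ∈ D (0 : Zn n) ((2 ^ K : ℕ) : ℤ), 3 / ω * u x + (-(3 / ω) * m) ≤ θ
  · by_cases c2 : ∃ x ∈ D (0 : Zn n) ((2 ^ K : ℕ) : ℤ), (-(3 / ω)) * u x + ((3 / ω) * (m + ω)) ≤ θ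
    · exfalso
      have h1 := h1 c1
      have h2 := h2 c2
      have h3 : (Q K (0 : Zn n)) ⊆ (Q K (0 : Zn n)).filter (fun x => 1 < 3 / ω * u x + (-(3 / ω) * m)) ∪
          (Q K (0 : Zn n)).filter (fun x => 1 < (-(3 / ω)) * u x + ((3 / ω) * (m + ω))) := by
        intro x hx
        rw [Finset.mem_union, Finset.mem_filter, Finset.mem_filter]
        by_cases h : 1 < 3 / ω * u x + (-(3 / ω) * m)
        · exact Or.inl ⟨hx, h⟩
        · refine Or.inr ⟨hx, ?_⟩
          push Not at h
          linarith
      have h4 := (Finset.card_le_card h3).trans (Finset.card_union_le _ _)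
      rw [card_Q] at h4
      have h5 : ((2 ^ K) ^ n : ℝ) ≤ ((Q K (0 : Zn n)).filter (fun x => 1 < 3 / ω * u x + (-(3 / ω) * m))).card +
          ((Q K (0 : Zn n)).filter (fun x => 1 < (-(3 / ω)) * u x + ((3 / ω) * (m + ω)))).card := by
        exact_mod_cast h4
      linarith
    · push Not at c2
      refine ⟨m, fun x hx => ⟨(hu x (hsub2 x hx)).1, ?_⟩⟩
      have h3 := c2 x hx
      have h4 : θ * ω < 3 * (m + ω - u x) := by
        have := mul_lt_mul_of_pos_right h3 hω
        have e : (-(3 / ω) * u x + 3 / ω * (m + ω)) * ω = 3 * (m + ω - u x) := by field_simp; ring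
        linarith
      linarith
  · push Not at c1
    refine ⟨m + θ / 3 * ω, fun x hx => ⟨?_, ?_⟩⟩
    · have h3 := c1 x hx
      have := mul_lt_mul_of_pos_right h3 hω
      have e : (3 / ω * u x + -(3 / ω) * m) * ω = 3 * (u x - m) := by field_simp; ring
      linarith
    · have := (hu x (hsub2 x hx)).2.1
      linarith

lemma holder_int (n : ℕ) {l L : ℝ} (hl : 0 < l) (hlL : l ≤ L) :
    ∃ C γ : ℝ, 0 < C ∧ 0 < γ ∧ γ < 1 ∧ ∀ (K0 : ℕ) (u : Zn n → ℝ),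
      (∀ x ∈ D 0 ((2 ^ K0 : ℕ) : ℤ), |u x| ≤ 1 ∧ Sol l L u x) →
      ∀ d : ℕ, 1 ≤ d → d ≤ 2 ^ K0 → ∀ y ∈ D (0 : Zn n) (d : ℤ),
        |u y - u 0| ≤ C * ((d : ℝ) / 2 ^ K0) ^ γ := by
  obtain ⟨η, q, hη, hη1, hq, hosc⟩ := osc_step n hl hlL
  obtain ⟨γ, hγ0, hγ1, hγ⟩ : ∃ γ : ℝ, 0 < γ ∧ γ < 1 ∧ 1 - η ≤ (((2 : ℝ) ^ q)⁻¹) ^ γ := by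
    have hb : (0 : ℝ) < ((2 : ℝ) ^ q)⁻¹ := by positivity
    have hcont : Filter.Tendsto (fun γ : ℝ => (((2 : ℝ) ^ q)⁻¹) ^ γ) (nhdsWithin 0 (Set.Ioi 0)) (nhds 1) := by
      have : ContinuousAt (fun γ : ℝ => (((2 : ℝ) ^ q)⁻¹) ^ γ) 0 :=
        Real.continuousAt_const_rpow hb.ne'
      have h2 := this.tendsto
      rw [Real.rpow_zero] at h2
      exact h2.mono_left nhdsWithin_le_nhds
    have h1 := hcont.eventually (lt_mem_nhds (show 1 - η < 1 by linarith))
    have h2 : ∀ᶠ γ : ℝ in nhdsWithin 0 (Set.Ioi 0), 0 < γ ∧ γ < 1 :=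
      Ioo_mem_nhdsGT (show (0 : ℝ) < 1 by norm_num)
    obtain ⟨γ, h3, h4⟩ := (h1.and h2).exists
    exact ⟨γ, h4.1, h4.2, h3.le⟩
  refine ⟨2 * ((2 : ℝ) ^ (q + 1)) ^ γ, γ, by positivity, hγ0, hγ1, ?_⟩
  intro K0 u hu d hd hdK y hy
  have hDsub : ∀ K ≤ K0, ∀ x ∈ D (0 : Zn n) ((2 ^ K : ℕ) : ℤ), x ∈ D (0 : Zn n) ((2 ^ K0 : ℕ) : ℤ) := by
    intro K hK x hx
    apply D_mono _ hx
    intro i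
    simp only [sub_self, abs_zero, zero_add]
    have : 2 ^ K ≤ 2 ^ K0 := Nat.pow_le_pow_right (by norm_num) hK
    exact_mod_cast this
  have iter : ∀ j K : ℕ, K + q * j = K0 → ∃ m, ∀ x ∈ D (0 : Zn n) ((2 ^ K : ℕ) : ℤ),
      m ≤ u x ∧ u x ≤ m + 2 * (1 - η) ^ j := by
    intro j
    induction j with
    | zero =>
      intro K hK
      refine ⟨-1, fun x hx => ?_⟩
      have := abs_le.1 (hu x (hDsub K (by omega) x hx)).1
      constructor
      · linarith [this.1]
      · rw [pow_zero]; linarith [this.2]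
    | succ j ih =>
      intro K hK
      obtain ⟨m, hm⟩ := ih (K + q) (by rw [← hK]; ring)
      have hle : K + q ≤ K0 := by rw [← hK]; nlinarith
      obtain ⟨m', hm'⟩ := hosc K u m (2 * (1 - η) ^ j) (by
        have : 0 < 1 - η := by linarith
        positivity) (fun x hx => ⟨(hm x hx).1, (hm x hx).2, (hu x (hDsub _ hle x hx)).2⟩)
      refine ⟨m', fun x hx => ⟨(hm' x hx).1, (hm' x hx).2.trans (le_of_eq ?_)⟩⟩
      ring
  set t := Nat.clog 2 d with ht
  have h1 : d ≤ 2 ^ t := Nat.le_pow_clog (by norm_num) d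
  have h2 : 2 ^ t ≤ 2 * d := by
    rcases Nat.eq_or_lt_of_le hd with h | h
    · rw [ht, ← h]; simp
    · have h3 := Nat.pow_pred_clog_lt_self (b := 2) (by norm_num) h
      have h4 : 0 < t := Nat.clog_pos (by norm_num) h
      rw [← ht] at h3
      obtain ⟨t', ht'⟩ : ∃ t', t = t' + 1 := ⟨t - 1, by omega⟩
      rw [ht'] at h3 ⊢
      simp at h3
      rw [pow_succ]; omega
  have h3 : t ≤ K0 := Nat.clog_le_of_le_pow hdK
  set j := (K0 - t) / q with hj
  have h4 : q * j ≤ K0 - t := Nat.mul_div_le _ _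
  have h5 : K0 - t < q * j + q := by
    have := Nat.lt_mul_div_succ (K0 - t) (show 0 < q by omega)
    rw [mul_add, mul_one] at this
    exact this
  obtain ⟨m, hm⟩ := iter j (K0 - q * j) (by omega)
  have hdle : (d : ℤ) ≤ ((2 ^ (K0 - q * j) : ℕ) : ℤ) := by
    have : 2 ^ t ≤ 2 ^ (K0 - q * j) := Nat.pow_le_pow_right (by norm_num) (by omega)
    exact_mod_cast h1.trans this
  have hy' := hm y (D_mono (fun i => by simpa using hdle) hy)
  have h0' := hm 0 (by rw [mem_D]; intro i; simp)
  have h6 : |u y - u 0| ≤ 2 * (1 - η) ^ j := by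
    rw [abs_le]; constructor <;> linarith [hy'.1, hy'.2, h0'.1, h0'.2]
  refine h6.trans ?_
  rw [mul_assoc, ← Real.mul_rpow (by positivity) (by positivity)]
  apply mul_le_mul_of_nonneg_left _ (by norm_num)
  calc (1 - η) ^ j ≤ ((((2 : ℝ) ^ q)⁻¹) ^ γ) ^ j := pow_le_pow_left₀ (by linarith) hγ j
    _ = ((((2 : ℝ) ^ q)⁻¹) ^ j) ^ γ := by
        rw [Real.rpow_pow_comm (by positivity)]
    _ ≤ (2 ^ (q + 1) * ((d : ℝ) / 2 ^ K0)) ^ γ := by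
        apply Real.rpow_le_rpow (by positivity) _ hγ0.le
        rw [inv_pow, ← pow_mul, mul_div_assoc', inv_le_comm₀ (by positivity) (by positivity), inv_div,
          div_le_iff₀ (by positivity)]
        have h7 : 2 ^ K0 ≤ 2 ^ (q * j) * (2 ^ (q + 1) * d) := by
          calc 2 ^ K0 ≤ 2 ^ (t + q * j + q) := Nat.pow_le_pow_right (by norm_num) (by omega)
            _ = 2 ^ (q * j) * (2 ^ q * 2 ^ t) := by ring
            _ ≤ 2 ^ (q * j) * (2 ^ q * (2 * d)) := by gcongr
            _ = _ := by ring
        exact_mod_cast h7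

def emb (ε : ℝ) (m : Zn n) : EuclideanSpace ℝ (Fin n) := WithLp.toLp 2 (fun i => ε * m i)

lemma emb_apply (ε : ℝ) (m : Zn n) (i : Fin n) : emb ε m i = ε * m i := rfl

lemma emb_add (ε : ℝ) (m : Zn n) (i : Fin n) : emb ε (m + ee i) = emb ε m + EuclideanSpace.single i ε := by
  ext j
  by_cases h : j = i
  · subst h; simp [emb_apply, ee_same]; ring
  · simp [emb_apply, ee_ne h, h]

lemma emb_sub (ε : ℝ) (m : Zn n) (i : Fin n) : emb ε (m - ee i) = emb ε m - EuclideanSpace.single i ε := by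
  ext j
  by_cases h : j = i
  · subst h; simp [emb_apply, ee_same]; ring
  · simp [emb_apply, ee_ne h, h]

lemma emb_zero (ε : ℝ) : emb ε (0 : Zn n) = 0 := by
  ext j; simp [emb_apply]

lemma norm_emb_le {ε : ℝ} (hε : 0 < ε) {R : ℤ} {m : Zn n} (hm : m ∈ D 0 R) (hR : 0 ≤ R) :
    ‖emb ε m‖ ≤ n * ε * R := by
  have hR' : (0 : ℝ) ≤ R := by exact_mod_cast hR
  rw [EuclideanSpace.norm_eq, Real.sqrt_le_left (by positivity)]
  have h1 : ∑ i, ‖emb ε m i‖ ^ 2 ≤ ∑ i : Fin n, (ε * R) ^ 2 := by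
    refine Finset.sum_le_sum fun i _ => ?_
    have h2 := mem_D.1 hm i
    simp only [Pi.zero_apply, zero_sub, zero_add] at h2
    have h3 : |(m i : ℝ)| ≤ R := by
      have : |m i| ≤ R := abs_le.2 h2
      exact_mod_cast this
    rw [emb_apply, Real.norm_eq_abs, abs_mul, abs_of_pos hε]
    gcongr
  refine h1.trans ?_
  simp only [Finset.sum_const, Finset.card_univ, Fintype.card_fin, nsmul_eq_mul]
  have h4 : (n : ℝ) ≤ n ^ 2 := by
    have : n ≤ n ^ 2 := Nat.le_self_pow (by norm_num) n
    exact_mod_cast this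
  calc (n : ℝ) * (ε * R) ^ 2 ≤ n ^ 2 * (ε * R) ^ 2 := by gcongr
    _ = _ := by ring

end DH

/-- **Hölder estimate for discrete elliptic difference equations, uniform in the mesh size.** -/
theorem discrete_holder_estimate (n : ℕ) (lmin lmax : ℝ)
    (hmin : 0 < lmin) (hminmax : lmin ≤ lmax) :
    ∃ C γ : ℝ, 0 < C ∧ 0 < γ ∧ γ < 1 ∧
      ∀ ε : ℝ, 0 < ε →
      ∀ lam : Fin n → En n → ℝ,
        (∀ i x, lmin ≤ lam i x ∧ lam i x ≤ lmax) →
      ∀ u : En n → ℝ,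
        (∀ x, IsLatticePoint ε x → x ∈ ball (0 : En n) 1 → |u x| ≤ 1) →
        (∀ x, IsLatticePoint ε x → x ∈ ball (0 : En n) 1 →
          (∀ i, x + EuclideanSpace.single i ε ∈ ball (0 : En n) 1 ∧
                x - EuclideanSpace.single i ε ∈ ball (0 : En n) 1) →
          discreteL ε lam u x = 0) →
        ∀ x y, IsLatticePoint ε x → IsLatticePoint ε y →
          x ∈ ball (0 : En n) (1 / 2) → y ∈ ball (0 : En n) (1 / 2) →
          |u x - u y| ≤ C * ‖x - y‖ ^ γ := by
  obtain ⟨C, γ, hC, hγ0, hγ1, hH⟩ := DH.holder_int n hmin hminmax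
  refine ⟨(C + 2) * (8 * (n + 1)) ^ γ, γ, by positivity, hγ0, hγ1, ?_⟩
  intro ε hε lam hlam u hu1 hu2 x y hx hy hxB hyB
  rw [mem_ball_zero_iff] at hxB hyB
  rcases eq_or_ne x y with hxy | hxy
  · subst hxy
    simp only [sub_self, abs_zero, norm_zero]
    positivity
  choose mx hmx using hx
  choose my hmy using hy
  set m : DH.Zn n := fun i => my i - mx i with hm
  have hym : y = x + DH.emb ε m := by
    ext i
    rw [PiLp.add_apply, DH.emb_apply, hmx, hmy, hm]
    push_cast; ring
  set d : ℕ := Finset.univ.sup (fun i => (m i).natAbs) with hd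
  have hmd : m ∈ DH.D (0 : DH.Zn n) (d : ℤ) := by
    rw [DH.mem_D]
    intro i
    have : (m i).natAbs ≤ d := Finset.le_sup (f := fun i => (m i).natAbs) (Finset.mem_univ i)
    simp only [Pi.zero_apply]
    omega
  have hne : ∃ i, m i ≠ 0 := by
    by_contra! hc
    apply hxy
    have : m = 0 := funext hc
    rw [hym, this, DH.emb_zero, add_zero]
  obtain ⟨i0, hi0⟩ := hne
  have hd1 : 1 ≤ d := by
    have : (m i0).natAbs ≤ d := Finset.le_sup (f := fun i => (m i).natAbs) (Finset.mem_univ i0)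
    omega
  have hdn : ε * d ≤ ‖x - y‖ := by
    obtain ⟨i, _, hi⟩ := Finset.exists_mem_eq_sup Finset.univ ⟨i0, Finset.mem_univ i0⟩ (fun i => (m i).natAbs)
    have h1 : ‖(x - y) i‖ ≤ ‖x - y‖ := PiLp.norm_apply_le (x - y) i
    have h2 : (x - y) i = - (ε * m i) := by
      rw [hym]; simp [DH.emb_apply]
    rw [h2, norm_neg, Real.norm_eq_abs, abs_mul, abs_of_pos hε] at h1
    have h3 : (d : ℝ) = |(m i : ℝ)| := by
      rw [hd, hi, Nat.cast_natAbs, Int.cast_abs]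
    rw [h3]; exact h1
  have hlat : ∀ k : DH.Zn n, IsLatticePoint ε (x + DH.emb ε k) := by
    intro k i
    refine ⟨mx i + k i, ?_⟩
    rw [PiLp.add_apply, DH.emb_apply, hmx]
    push_cast; ring
  have hux : |u x| ≤ 1 := hu1 x (fun i => ⟨mx i, hmx i⟩) (by rw [mem_ball_zero_iff]; linarith)
  have huy : |u y| ≤ 1 := hu1 y (fun i => ⟨my i, hmy i⟩) (by rw [mem_ball_zero_iff]; linarith)
  have htriv : |u x - u y| ≤ 2 := by
    rw [abs_le] at *
    constructor <;> linarith [hux.1, hux.2, huy.1, huy.2]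
  have hn0 : (0 : ℝ) ≤ n := by positivity
  have hnpos : (0 : ℝ) < 8 * (n + 1) := by positivity
  rw [mul_assoc, ← Real.mul_rpow (by positivity) (by positivity)]
  -- far case
  have hfar : 1 ≤ 8 * ((n : ℝ) + 1) * ‖x - y‖ →
      |u x - u y| ≤ (C + 2) * (8 * (n + 1) * ‖x - y‖) ^ γ := by
    intro h
    have h1 := Real.one_le_rpow h hγ0.le
    have : (C + 2) * 1 ≤ (C + 2) * (8 * ((n : ℝ) + 1) * ‖x - y‖) ^ γ := by gcongr
    linarith
  have hd1' : (1 : ℝ) ≤ d := by exact_mod_cast hd1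
  by_cases hεbig : 1 ≤ 4 * ((n : ℝ) + 1) * ε
  · apply hfar
    have : ε ≤ ‖x - y‖ := by nlinarith
    nlinarith
  push Not at hεbig
  set b : ℝ := 1 / (2 * (n + 1) * ε) with hb
  have hb' : b * (2 * (n + 1) * ε) = 1 := by rw [hb]; field_simp
  have hb2 : 2 < b := by
    rw [hb, lt_div_iff₀ (by positivity)]; linarith
  set N : ℕ := ⌊b - 1⌋₊ with hN
  have hN1 : 1 ≤ N := by
    rw [hN, Nat.one_le_floor_iff]; linarith
  have hNle : (N : ℝ) ≤ b - 1 := Nat.floor_le (by linarith)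
  have hNlt : b - 1 < N + 1 := Nat.lt_floor_add_one _
  set K0 := Nat.log 2 N with hK0
  have hK1 : 2 ^ K0 ≤ N := Nat.pow_log_le_self 2 (by omega)
  have hK2 : N + 1 ≤ 2 ^ (K0 + 1) := Nat.lt_pow_succ_log_self (by norm_num) N
  have hK1' : (2 : ℝ) ^ K0 ≤ N := by exact_mod_cast hK1
  have hK2' : (N : ℝ) + 1 ≤ 2 ^ K0 * 2 := by rw [← pow_succ]; exact_mod_cast hK2
  have hscale : 1 ≤ 8 * ((n : ℝ) + 1) * (ε * 2 ^ K0) := by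
    have h1 : b ≤ 4 * 2 ^ K0 := by linarith
    have h2 := mul_le_mul_of_nonneg_right h1 (show 0 ≤ 2 * ((n : ℝ) + 1) * ε by positivity)
    linarith
  by_cases hdK : d ≤ 2 ^ K0
  · have hball : ∀ k ∈ DH.D (0 : DH.Zn n) ((2 ^ K0 + 1 : ℕ) : ℤ), x + DH.emb ε k ∈ ball (0 : En n) 1 := by
      intro k hk
      rw [mem_ball_zero_iff]
      have h1 := DH.norm_emb_le hε hk (by positivity)
      have h2 := norm_add_le x (DH.emb ε k)
      have h3 : (n : ℝ) * ε * (((2 ^ K0 + 1 : ℕ) : ℤ) : ℝ) ≤ 1 / 2 := by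
        push_cast
        have h4 : (2 : ℝ) ^ K0 + 1 ≤ b := by linarith
        have h5 := mul_le_mul_of_nonneg_left h4 (show 0 ≤ ((n : ℝ) + 1) * ε by positivity)
        have h6 : 0 ≤ ε * ((2 : ℝ) ^ K0 + 1) := by positivity
        linarith
      linarith
    have h := hH K0 (fun k => u (x + DH.emb ε k)) (by
      intro k hk
      have hk' : k ∈ DH.D (0 : DH.Zn n) ((2 ^ K0 + 1 : ℕ) : ℤ) := by
        apply DH.D_mono _ hk
        intro i; simp
      refine ⟨hu1 _ (hlat k) (hball k hk'), fun i => lam i (x + DH.emb ε k), fun i => hlam i _, ?_⟩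
      have h1 := hu2 _ (hlat k) (hball k hk') (fun i => by
        constructor
        · have := hball _ (DH.add_mem_D hk (R' := ((2 ^ K0 + 1 : ℕ) : ℤ)) (by push_cast; omega) i)
          rw [DH.emb_add, ← add_assoc] at this
          exact this
        · have := hball _ (DH.sub_mem_D hk (R' := ((2 ^ K0 + 1 : ℕ) : ℤ)) (by push_cast; omega) i)
          rw [DH.emb_sub, ← add_sub_assoc] at this
          exact this)
      rw [discreteL, ← Finset.sum_div, div_eq_zero_iff] at h1
      rcases h1 with h1 | h1
      · rw [← h1]
        refine Finset.sum_congr rfl fun i _ => ?_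
        simp only [DH.dd]
        rw [DH.emb_add, DH.emb_sub, ← add_assoc, ← add_sub_assoc]
      · exact absurd h1 (by positivity)) d hd1 hdK m hmd
    simp only [DH.emb_zero, add_zero] at h
    rw [← hym, abs_sub_comm] at h
    refine h.trans ?_
    have h2 : (d : ℝ) / 2 ^ K0 ≤ 8 * (n + 1) * ‖x - y‖ := by
      rw [div_le_iff₀ (by positivity)]
      have h3 := mul_le_mul_of_nonneg_left hscale (show (0 : ℝ) ≤ d by positivity)
      have h4 := mul_le_mul_of_nonneg_left hdn (show (0 : ℝ) ≤ 8 * (n + 1) * 2 ^ K0 by positivity)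
      linarith
    have h3 := Real.rpow_le_rpow (by positivity) h2 hγ0.le
    apply mul_le_mul (by linarith) h3 (by positivity) (by linarith)
  · push Not at hdK
    apply hfar
    have h1 : (2 : ℝ) ^ K0 ≤ d := by exact_mod_cast hdK.le
    have h2 : ε * 2 ^ K0 ≤ ‖x - y‖ := (mul_le_mul_of_nonneg_left h1 hε.le).trans hdn
    have h3 := mul_le_mul_of_nonneg_left h2 hnpos.le
    linarith
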